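/- There is no infinite run of the p-adic Jacobi–Perron algorithm admitting integers x_1, …, x_{m+1} with gcd(x_1,…,x_{m+1}) = 1 and x_1 α_0^{(1)} + ⋯ + x_m α_0^{(m)} + x_{m+1} = 0 in ℚ_p, together with an integer k such that v_p(S_n) ≥ n + k for all n ≥ 0 (i.e., such that the sequence (S_n / p^n) has bounded denominator); under these hypotheses the Jacobi–Perron algorithm stops in finitely many steps. -/

import Mathlib

open Finset Filter

/-- `q` belongs to `ℤ[1/p]`. -/
def InZInvP (p : ℕ) (q : ℚ) : Prop := ∃ (z : ℤ) (k : ℕ), q = (z : ℚ) / (p : ℚ) ^ k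

/-- `a` is the Browkin `s`-function value of `x`:
`a ∈ ℤ[1/p]`, `|a|_∞ < p/2` and `|x - a|_p < 1`. -/
def IsSValue (p : ℕ) [Fact p.Prime] (x : ℚ_[p]) (a : ℚ) : Prop :=
  InZInvP p a ∧ |a| < (p : ℚ) / 2 ∧ ‖x - (a : ℚ_[p])‖ < 1

/-- An infinite run of the `p`-adic Jacobi–Perron algorithm with complete quotients
`α n i` and partial quotients `a n i` (`n ≥ 0`, `i = 1,…,m`). -/
def JPRun (p : ℕ) [Fact p.Prime] (m : ℕ) (α : ℕ → ℕ → ℚ_[p]) (a : ℕ → ℕ → ℚ) : Prop :=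
  ∀ n : ℕ,
    (∀ i ∈ Finset.Icc 1 m, IsSValue p (α n i) (a n i)) ∧
    α n m ≠ ((a n m : ℚ) : ℚ_[p]) ∧
    α (n + 1) 1 = (α n m - ((a n m : ℚ) : ℚ_[p]))⁻¹ ∧
    ∀ i ∈ Finset.Icc 2 m,
      α (n + 1) i = (α n (i - 1) - ((a n (i - 1) : ℚ) : ℚ_[p])) / (α n m - ((a n m : ℚ) : ℚ_[p]))

/-- `A : ℤ → ℕ → ℚ` is the family of convergent numerators/denominators attached to the
partial quotients `a`: `A (-j) i = δ_{ij}` for `j = 1,…,m+1`, and for `n ≥ 0`,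
`A n i = Σ_{j=1}^m a n j * A (n-j) i + A (n-m-1) i`. -/
def JPConv (m : ℕ) (a : ℕ → ℕ → ℚ) (A : ℤ → ℕ → ℚ) : Prop :=
  (∀ i ∈ Finset.Icc 1 (m + 1), ∀ j ∈ Finset.Icc 1 (m + 1),
      A (-(j : ℤ)) i = if i = j then 1 else 0) ∧
  (∀ n : ℕ, ∀ i ∈ Finset.Icc 1 (m + 1),
      A n i = (∑ j ∈ Finset.Icc 1 m, a n j * A ((n : ℤ) - j) i) + A ((n : ℤ) - m - 1) i)

theorem InZInvP.int (p : ℕ) (z : ℤ) : InZInvP p (z : ℚ) := ⟨z, 0, by simp⟩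

theorem InZInvP.mul {p : ℕ} {q r : ℚ} (hq : InZInvP p q) (hr : InZInvP p r) :
    InZInvP p (q * r) := by
  obtain ⟨z, k, rfl⟩ := hq
  obtain ⟨w, l, rfl⟩ := hr
  exact ⟨z * w, k + l, by push_cast; rw [pow_add, div_mul_div_comm]⟩

theorem InZInvP.add {p : ℕ} (hp : p ≠ 0) {q r : ℚ} (hq : InZInvP p q) (hr : InZInvP p r) :
    InZInvP p (q + r) := by
  obtain ⟨z, k, rfl⟩ := hq
  obtain ⟨w, l, rfl⟩ := hr
  have h : (p : ℚ) ≠ 0 := by exact_mod_cast hp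
  refine ⟨z * (p : ℤ) ^ l + w * (p : ℤ) ^ k, k + l, ?_⟩
  push_cast
  rw [pow_add, div_add_div _ _ (pow_ne_zero _ h) (pow_ne_zero _ h)]
  ring

theorem InZInvP.sum {p : ℕ} (hp : p ≠ 0) (s : Finset ℕ) (f : ℕ → ℚ)
    (h : ∀ i ∈ s, InZInvP p (f i)) : InZInvP p (∑ i ∈ s, f i) := by
  apply Finset.sum_induction f (InZInvP p) (fun _ _ h1 h2 => InZInvP.add hp h1 h2) _ h
  simpa using InZInvP.int p 0

theorem InZInvP.le_abs {p : ℕ} [hp : Fact p.Prime] {q : ℚ} (hq : InZInvP p q) (h0 : q ≠ 0)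
    {e : ℤ} (he : e ≤ padicValRat p q) : (p : ℚ) ^ e ≤ |q| := by
  obtain ⟨z, l, rfl⟩ := hq
  have hpp : (p : ℚ) ≠ 0 := by exact_mod_cast hp.out.ne_zero
  have hp0 : (0 : ℚ) < p := by exact_mod_cast hp.out.pos
  have hp1 : (1 : ℚ) ≤ p := by exact_mod_cast hp.out.one_le
  have hz : z ≠ 0 := by rintro rfl; simp at h0
  have hzq : (z : ℚ) ≠ 0 := by exact_mod_cast hz
  rw [padicValRat.div hzq (pow_ne_zero _ hpp), padicValRat.pow,
    padicValRat.self hp.out.one_lt, padicValRat.of_int] at he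
  have h1 : ((p : ℤ) ^ padicValInt p z) ≤ |z| :=
    Int.le_of_dvd (abs_pos.mpr hz) ((dvd_abs _ _).mpr (padicValInt_dvd z))
  have h2 : ((p : ℚ) ^ padicValInt p z) ≤ |(z : ℚ)| := by exact_mod_cast h1
  calc (p : ℚ) ^ e ≤ (p : ℚ) ^ ((padicValInt p z : ℤ) - (l : ℤ)) :=
        zpow_le_zpow_right₀ hp1 (by linarith)
    _ = (p : ℚ) ^ padicValInt p z / (p : ℚ) ^ l := by
        rw [zpow_sub₀ hpp]; simp
    _ ≤ |(z : ℚ)| / (p : ℚ) ^ l := by gcongr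
    _ = _ := by rw [abs_div, abs_pow, abs_of_pos hp0]

theorem jp_coeff_sum (q : ℚ) (hq0 : 0 < q) (hq : q ≤ 1 / 3) (m : ℕ) :
    ∑ j ∈ Finset.Icc 1 m, (1 / 2) * q ^ (j - 1) ≤ 3 / 4 * (1 - q ^ m) := by
  induction m with
  | zero => simp
  | succ m ih =>
    rw [Finset.sum_Icc_succ_top (by omega), Nat.add_sub_cancel, pow_succ]
    have : 0 < q ^ m := by positivity
    nlinarith

/-- Contraction. -/
theorem jp_contract (m : ℕ) (c : ℕ → ℕ → ℚ) (T : ℕ → ℚ)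
    (hc : ∀ n, ∑ j ∈ Finset.Icc 1 (m + 1), |c n j| ≤ 3 / 4)
    (hT : ∀ n, T (n + m + 1) = ∑ j ∈ Finset.Icc 1 (m + 1), c n j * T (n + m + 1 - j)) :
    ∃ B : ℚ, 0 < B ∧ ∀ N : ℕ, ∃ n0, ∀ n ≥ n0, |T n| ≤ (3 / 4) ^ N * B := by
  have key : ∀ n (B : ℚ), (∀ j ∈ Finset.Icc 1 (m + 1), |T (n + m + 1 - j)| ≤ B) →
      |T (n + m + 1)| ≤ 3 / 4 * B := by
    intro n B hB
    have hB0 : 0 ≤ B := (abs_nonneg _).trans (hB 1 (by simp))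
    rw [hT n]
    calc _ ≤ ∑ j ∈ Finset.Icc 1 (m + 1), |c n j * T (n + m + 1 - j)| :=
          Finset.abs_sum_le_sum_abs _ _
      _ ≤ ∑ j ∈ Finset.Icc 1 (m + 1), |c n j| * B := by
          apply Finset.sum_le_sum
          intro j hj
          rw [abs_mul]
          exact mul_le_mul_of_nonneg_left (hB j hj) (abs_nonneg _)
      _ = (∑ j ∈ Finset.Icc 1 (m + 1), |c n j|) * B := by rw [Finset.sum_mul]
      _ ≤ _ := mul_le_mul_of_nonneg_right (hc n) hB0
  refine ⟨1 + ∑ i ∈ Finset.range (m + 1), |T i|, ?_, ?_⟩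
  · have : 0 ≤ ∑ i ∈ Finset.range (m + 1), |T i| :=
      Finset.sum_nonneg fun _ _ => abs_nonneg _
    linarith
  set B := 1 + ∑ i ∈ Finset.range (m + 1), |T i| with hBdef
  intro N
  induction N with
  | zero =>
    refine ⟨0, fun n _ => ?_⟩
    simp only [pow_zero, one_mul]
    induction n using Nat.strong_induction_on with
    | _ n ih =>
      by_cases hn : n < m + 1
      · have := Finset.single_le_sum (f := fun i => |T i|) (fun i _ => abs_nonneg _)
          (Finset.mem_range.mpr hn)
        try simp only at this
        linarith
      · obtain ⟨l, rfl⟩ : ∃ l, n = l + m + 1 := ⟨n - (m + 1), by omega⟩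
        have h := key l B (fun j hj => by
          rw [Finset.mem_Icc] at hj
          exact ih _ (by omega) (by omega))
        have := abs_nonneg (T (l + m + 1))
        linarith
  | succ N ih =>
    obtain ⟨n0, h0⟩ := ih
    refine ⟨n0 + m + 1, fun n hn => ?_⟩
    obtain ⟨l, rfl⟩ : ∃ l, n = l + m + 1 := ⟨n - (m + 1), by omega⟩
    have h := key l _ (fun j hj => by
      rw [Finset.mem_Icc] at hj
      exact h0 (l + m + 1 - j) (by omega))
    rw [pow_succ]
    linarith

/-- There is no infinite run of the `p`-adic Jacobi–Perron algorithm admitting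
coprime integers `x₁, …, x_{m+1}` with `x₁α₀⁽¹⁾ + ⋯ + x_mα₀⁽ᵐ⁾ + x_{m+1} = 0` and an integer `k`
with `v_p(Sₙ) ≥ n + k` for all `n ≥ 0` (the disjunct `Sₙ = 0` accounts for `v_p(0) = +∞`). -/
theorem jacobiPerron_bounded_denominator_finiteness (p m : ℕ) [hp : Fact p.Prime]
    (hp2 : 2 < p) (hm : 1 ≤ m)
    (α : ℕ → ℕ → ℚ_[p]) (a : ℕ → ℕ → ℚ) (A : ℤ → ℕ → ℚ)
    (hrun : JPRun p m α a) (hconv : JPConv m a A)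
    (x : ℕ → ℤ) (hgcd : Finset.gcd (Finset.Icc 1 (m + 1)) x = 1)
    (hdep : (∑ i ∈ Finset.Icc 1 m, ((x i : ℚ) : ℚ_[p]) * α 0 i) + ((x (m + 1) : ℤ) : ℚ_[p]) = 0)
    (S : ℤ → ℚ)
    (hS : ∀ n : ℤ, S n = ∑ i ∈ Finset.Icc 1 (m + 1), (x i : ℚ) * A (n - 1) i)
    (k : ℤ)
    (hbdd : ∀ n : ℕ, S n = 0 ∨ (n : ℤ) + k ≤ padicValRat p (S n)) :
    False := by
  have hp0 : p ≠ 0 := hp.out.ne_zero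
  have hpq0 : (p : ℚ) ≠ 0 := by exact_mod_cast hp0
  have hpq : (0 : ℚ) < p := by exact_mod_cast hp.out.pos
  have hp3 : (3 : ℚ) ≤ p := by exact_mod_cast hp2
  obtain ⟨hA0, hA⟩ := hconv
  -- initial values
  have hSx : ∀ j ∈ Finset.Icc 1 (m + 1), S (1 - (j : ℤ)) = x j := by
    intro j hj
    rw [hS, show (1 - (j : ℤ) - 1) = -(j : ℤ) by ring]
    rw [Finset.sum_congr rfl (fun i hi => by rw [hA0 i hi j hj])]
    simp only [mul_ite, mul_one, mul_zero, Finset.sum_ite_eq', if_pos hj]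
  -- recurrence
  have hSrec : ∀ n : ℕ, S ((n : ℤ) + 1) =
      (∑ j ∈ Finset.Icc 1 m, a n j * S ((n : ℤ) + 1 - j)) + S ((n : ℤ) - m) := by
    intro n
    rw [hS, show (n : ℤ) + 1 - 1 = n by ring,
      Finset.sum_congr rfl (fun i hi => by rw [hA n i hi, mul_add]), Finset.sum_add_distrib]
    congr 1
    · simp_rw [hS, Finset.mul_sum]
      rw [Finset.sum_comm]
      refine Finset.sum_congr rfl fun j _ => Finset.sum_congr rfl fun i _ => ?_
      rw [show (n : ℤ) + 1 - j - 1 = n - j by ring]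
      ring
    · rw [hS]
  set U : ℕ → ℚ := fun n => S ((n : ℤ) - m) with hU
  have hUrec : ∀ n : ℕ, U (n + m + 1) =
      (∑ j ∈ Finset.Icc 1 m, a n j * U (n + m + 1 - j)) + U n := by
    intro n
    have h := hSrec n
    simp only [hU]
    rw [show ((n + m + 1 : ℕ) : ℤ) - m = n + 1 by push_cast; ring, h]
    congr 1
    refine Finset.sum_congr rfl fun j hj => ?_
    rw [Finset.mem_Icc] at hj
    congr 2
    rw [Nat.cast_sub (by omega)]
    push_cast
    ring
  have hUx : ∀ j ∈ Finset.Icc 1 (m + 1), U (m + 1 - j) = x j := by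
    intro j hj
    rw [← hSx j hj]
    rw [Finset.mem_Icc] at hj
    simp only [hU]
    congr 1
    rw [Nat.cast_sub (by omega)]
    push_cast
    ring
  have hUZ : ∀ n, InZInvP p (U n) := by
    intro n
    induction n using Nat.strong_induction_on with
    | _ n ih =>
      by_cases hn : n < m + 1
      · have h := hUx (m + 1 - n) (by rw [Finset.mem_Icc]; omega)
        rw [show m + 1 - (m + 1 - n) = n by omega] at h
        rw [h]
        exact InZInvP.int p _
      · obtain ⟨l, rfl⟩ : ∃ l, n = l + m + 1 := ⟨n - (m + 1), by omega⟩
        rw [hUrec]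
        refine InZInvP.add hp0 (InZInvP.sum hp0 _ _ fun j hj => ?_) (ih _ (by omega))
        refine InZInvP.mul ((hrun l).1 j hj).1 (ih _ ?_)
        rw [Finset.mem_Icc] at hj
        omega
  -- contraction
  obtain ⟨B, hB, hcon⟩ := jp_contract m
    (fun n j => (if j = m + 1 then 1 else a n j) * ((p : ℚ)⁻¹) ^ j)
    (fun n => U n / (p : ℚ) ^ n) (by
      intro n
      rw [Finset.sum_Icc_succ_top (by omega)]
      have hq0 : (0 : ℚ) < (p : ℚ)⁻¹ := by positivity
      have hq : (p : ℚ)⁻¹ ≤ 1 / 3 := by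
        rw [inv_le_comm₀ hpq (by norm_num)]
        simpa using hp3
      have h1 := jp_coeff_sum _ hq0 hq m
      have h2 : ∑ j ∈ Finset.Icc 1 m, |(if j = m + 1 then 1 else a n j) * ((p : ℚ)⁻¹) ^ j| ≤
          ∑ j ∈ Finset.Icc 1 m, (1 / 2) * ((p : ℚ)⁻¹) ^ (j - 1) := by
        refine Finset.sum_le_sum fun j hj => ?_
        have ha := ((hrun n).1 j hj).2.1
        rw [Finset.mem_Icc] at hj
        rw [if_neg (by omega), abs_mul, abs_of_pos (pow_pos hq0 j)]
        obtain ⟨i, rfl⟩ : ∃ i, j = i + 1 := ⟨j - 1, by omega⟩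
        rw [Nat.add_sub_cancel]
        calc _ ≤ ((p : ℚ) / 2) * ((p : ℚ)⁻¹) ^ (i + 1) :=
              mul_le_mul_of_nonneg_right ha.le (by positivity)
          _ = _ := by rw [pow_succ]; field_simp
      rw [if_pos rfl, one_mul, abs_of_pos (pow_pos hq0 _), pow_succ]
      have h3 := pow_pos hq0 m
      nlinarith)
    (by
      intro n
      have hdiv : ∀ j ≤ n + m + 1, U (n + m + 1 - j) / (p : ℚ) ^ (n + m + 1) =
          ((p : ℚ)⁻¹) ^ j * (U (n + m + 1 - j) / (p : ℚ) ^ (n + m + 1 - j)) := by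
        intro j hj
        have : (p : ℚ) ^ (n + m + 1) = (p : ℚ) ^ (n + m + 1 - j) * (p : ℚ) ^ j := by
          rw [← pow_add]; congr 1; omega
        rw [this, inv_pow]
        field_simp
      rw [Finset.sum_Icc_succ_top (by omega)]
      simp only []
      rw [hUrec, add_div, Finset.sum_div]
      congr 1
      · refine Finset.sum_congr rfl fun j hj => ?_
        rw [Finset.mem_Icc] at hj
        rw [if_neg (by omega), mul_div_assoc, hdiv j (by omega)]
        ring
      · have h := hdiv (m + 1) (by omega)
        rw [show n + m + 1 - (m + 1) = n by omega] at h ⊢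
        rw [h]; simp)
  -- eventually zero
  have hδ : (0 : ℚ) < (p : ℚ) ^ (k - m) / B := by positivity
  obtain ⟨N, hN⟩ := exists_pow_lt_of_lt_one hδ (by norm_num : (3 / 4 : ℚ) < 1)
  obtain ⟨n0, hn0⟩ := hcon N
  have hzero : ∀ n ≥ n0 + m, U n = 0 := by
    intro n hn
    by_contra hne
    obtain ⟨l, rfl⟩ : ∃ l, n = l + m := ⟨n - m, by omega⟩
    have hUl : U (l + m) = S l := by simp [hU]
    have hv : (l : ℤ) + k ≤ padicValRat p (U (l + m)) := by
      rw [hUl]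
      exact (hbdd l).resolve_left (hUl ▸ hne)
    have h1 := (hUZ (l + m)).le_abs hne hv
    have h2 := hn0 (l + m) (by omega)
    have hpp : (0 : ℚ) < (p : ℚ) ^ (l + m) := by positivity
    try simp only [] at h2
    rw [abs_div, abs_of_pos hpp, div_le_iff₀ hpp] at h2
    rw [lt_div_iff₀ hB] at hN
    have h3 : (p : ℚ) ^ ((l : ℤ) + k) = (p : ℚ) ^ (k - m) * (p : ℚ) ^ (l + m) := by
      rw [← zpow_natCast, ← zpow_add₀ hpq0]
      congr 1
      push_cast
      ring
    rw [h3] at h1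
    have := mul_lt_mul_of_pos_right hN hpp
    linarith
  have hback : ∀ d n, n0 + m ≤ n + d → U n = 0 := by
    intro d
    induction d with
    | zero => exact fun n hn => hzero n (by omega)
    | succ d ih =>
      intro n hn
      have h := hUrec n
      rw [ih (n + m + 1) (by omega), Finset.sum_eq_zero, zero_add] at h
      · exact h.symm
      · intro j hj
        rw [Finset.mem_Icc] at hj
        rw [ih _ (by omega), mul_zero]
  have hx0 : Finset.gcd (Finset.Icc 1 (m + 1)) x = 0 := by
    rw [Finset.gcd_eq_zero_iff]
    intro j hj
    have h := hUx j hj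
    rw [hback (n0 + m) _ (by omega)] at h
    exact_mod_cast h.symm
  rw [hx0] at hgcd
  exact zero_ne_one hgcd
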